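/- Let d ≥ 2 and M ≥ 1 be integers. For every integer k ≥ 1, G(M, k) ≥ 2^(-d) · G(0, k). -/

import Mathlib

/-- The vertices of the rooted `d`-ary tree of depth `k`: sequences over `Fin d`
of length at most `k`.  The root is the empty sequence, the children of a vertex
`l` with `l.length < k` are the vertices `l ++ [j]` for `j : Fin d`, and the
leaves are the vertices of length exactly `k`. -/
abbrev Vtx (d k : ℕ) : Type := {l : List (Fin d) // l.length ≤ k}

/-- The root `v₀` of the tree. -/
def rootV (d k : ℕ) : Vtx d k := ⟨[], by simp⟩

/-- `L_M(d,k)`: the set of integer-valued `M`-Lipschitz functions on the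
`d`-ary tree of depth `k` that vanish on all leaves. -/
def LM (d k M : ℕ) : Set (Vtx d k → ℤ) :=
  {f | (∀ v : Vtx d k, v.1.length = k → f v = 0) ∧
       (∀ (l : List (Fin d)) (hl : l.length + 1 ≤ k) (j : Fin d),
         |f ⟨l ++ [j], by simpa using hl⟩ - f ⟨l, Nat.le_of_succ_le hl⟩| ≤ (M : ℤ))}

/-- `G(t,k)`: the number of functions in `L_M(d,k)` whose value at the root is `t`. -/
noncomputable def G (d k M : ℕ) (t : ℤ) : ℕ :=
  Nat.card {f : Vtx d k → ℤ // f ∈ LM d k M ∧ f (rootV d k) = t}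

/-- The probability that a uniformly random element of `L_M(d,k)` takes the
value `t` at the root. -/
noncomputable def PrRoot (d k M : ℕ) (t : ℤ) : ℝ :=
  (G d k M t : ℝ) / (Nat.card (LM d k M) : ℝ)

/-- A function in `L_M(d,k)` is bounded by `M` times the distance to the leaves. -/
theorem abs_le_of_mem_LM {d k M : ℕ} (hd : 0 < d) {f : Vtx d k → ℤ} (hf : f ∈ LM d k M)
    (n : ℕ) : ∀ v : Vtx d k, v.1.length + n = k → |f v| ≤ (M : ℤ) * n := by
  induction n with
  | zero =>
    intro v hv
    simp [hf.1 v (by simpa using hv)]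
  | succ n ih =>
    rintro ⟨l, hl⟩ hv
    have hl' : l.length + 1 ≤ k := by simp at hv; omega
    have hchild := ih ⟨l ++ [⟨0, hd⟩], by simpa using hl'⟩ (by simp at hv ⊢; omega)
    have hedge := hf.2 l hl' ⟨0, hd⟩
    rw [abs_le] at *
    push_cast
    constructor <;> linarith [hchild.1, hchild.2, hedge.1, hedge.2]

theorem finite_LM {d k M : ℕ} (hd : 0 < d) : (LM d k M).Finite := by
  have : Finite (Vtx d k) := (List.finite_length_le (Fin d) k).to_subtype
  refine (Set.Finite.pi' (fun _ : Vtx d k =>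
    Set.finite_Icc (-((M : ℤ) * k)) ((M : ℤ) * k))).subset fun f hf v => ?_
  have hv := abs_le_of_mem_LM hd hf (k - v.1.length) v (Nat.add_sub_cancel' v.2)
  have hle : (M : ℤ) * (k - v.1.length : ℕ) ≤ (M : ℤ) * k := by
    gcongr
    omega
  exact abs_le.mp (hv.trans hle)

theorem neg_mem_LM {d k M : ℕ} {f : Vtx d k → ℤ} (hf : f ∈ LM d k M) : -f ∈ LM d k M := by
  refine ⟨fun v hv => by simp [hf.1 v hv], fun l hl j => ?_⟩
  have := hf.2 l hl j
  rw [abs_le] at this ⊢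
  simp only [Pi.neg_apply]
  constructor <;> linarith [this.1, this.2]

/-- The functions in `L_M(d,k)` whose root value is within `M` of `t`. -/
abbrev NearRoot (d k M : ℕ) (t : ℤ) : Type :=
  {g : Vtx d k → ℤ // g ∈ LM d k M ∧ |g (rootV d k) - t| ≤ (M : ℤ)}

theorem finite_nearRoot {d k M : ℕ} (hd : 0 < d) (t : ℤ) : Finite (NearRoot d k M t) :=
  ((finite_LM hd).subset fun _ hg => hg.1).to_subtype

/-- The function with value `t` at the root and `g j` on the subtree of the child `j`. -/
def graft {d k : ℕ} (t : ℤ) (g : Fin d → Vtx d k → ℤ) : Vtx d (k + 1) → ℤ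
  | ⟨[], _⟩ => t
  | ⟨j :: l, h⟩ => g j ⟨l, by simpa using h⟩

/-- A function in `L_M(d,k+1)` with root value `t` amounts to its restrictions to the
subtrees of the children of the root. -/
def rootEquiv (d k M : ℕ) (t : ℤ) :
    {f : Vtx d (k + 1) → ℤ // f ∈ LM d (k + 1) M ∧ f (rootV d (k + 1)) = t} ≃
      (Fin d → NearRoot d k M t) where
  toFun f j := ⟨fun v => f.1 ⟨j :: v.1, by simpa using v.2⟩,
    ⟨fun v hv => f.2.1.1 _ (by simpa using hv),
      fun l hl i => f.2.1.2 (j :: l) (by simpa using hl) i⟩, by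
    obtain ⟨f, hf, rfl⟩ := f
    exact hf.2 [] (by simp) j⟩
  invFun g := ⟨graft t fun j => (g j).1, ⟨by
      rintro ⟨_ | ⟨j, l⟩, h⟩ hv
      · simp at hv
      · exact (g j).2.1.1 _ (by simpa using hv), by
      rintro (_ | ⟨j, l⟩) hl i
      · exact (g i).2.2
      · exact (g j).2.1.2 l (by simpa using hl) i⟩, rfl⟩
  left_inv f := by
    ext ⟨_ | ⟨j, l⟩, h⟩
    · exact f.2.2.symm
    · rfl
  right_inv g := rfl

theorem G_succ (d k M : ℕ) (t : ℤ) : G d (k + 1) M t = Nat.card (NearRoot d k M t) ^ d := by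
  rw [G, Nat.card_congr (rootEquiv d k M t), Nat.card_fun, Nat.card_fin]

/-- Reflecting the functions with negative root value shows that at least half as many
functions have root value within `M` of `M` as within `M` of `0`. -/
theorem card_nearRoot_zero_le {d k M : ℕ} (hd : 0 < d) :
    Nat.card (NearRoot d k M 0) ≤ 2 * Nat.card (NearRoot d k M M) := by
  have := finite_nearRoot (k := k) (M := M) hd M
  let φ : NearRoot d k M 0 → NearRoot d k M M ⊕ NearRoot d k M M := fun g =>
    if h : 0 ≤ g.1 (rootV d k) then
      Sum.inl ⟨g.1, g.2.1, by have := g.2.2; rw [abs_le] at this ⊢; omega⟩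
    else
      Sum.inr ⟨-g.1, neg_mem_LM g.2.1, by
        have := g.2.2; rw [abs_le] at this ⊢; simp only [Pi.neg_apply]; omega⟩
  have hφ : Function.Injective φ := by
    intro g₁ g₂ h
    simp only [φ] at h
    split_ifs at h <;> simpa [Subtype.ext_iff] using h
  have := Nat.card_le_card_of_injective φ hφ
  rwa [Nat.card_sum, ← two_mul] at this

/-- For every `k ≥ 1`, `G(M,k) ≥ 2^(-d) * G(0,k)`. -/
theorem G_M_ge (d M : ℕ) (hd : 2 ≤ d) (hM : 1 ≤ M) (k : ℕ) (hk : 1 ≤ k) :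
    (2 : ℝ) ^ (-(d : ℤ)) * (G d k M 0 : ℝ) ≤ (G d k M (M : ℤ) : ℝ) := by
  obtain ⟨k, rfl⟩ := Nat.exists_eq_add_of_le' hk
  have h : G d (k + 1) M 0 ≤ 2 ^ d * G d (k + 1) M M := by
    rw [G_succ, G_succ, ← mul_pow]
    exact Nat.pow_le_pow_left (card_nearRoot_zero_le (by omega)) d
  rw [zpow_neg, zpow_natCast, inv_mul_le_iff₀ (by positivity)]
  exact_mod_cast h
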